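/- Let X be a countable type, let D₁ and D₂ be probability mass functions on X, and let ε ∈ [0,1] be such that for every x ∈ X with D₁(x) > 0 one has (1−ε)·D₁(x) ≤ D₂(x) ≤ (1+ε)·D₁(x) (and D₂(x) = 0 whenever D₁(x) = 0). Then the squared Hellinger distance satisfies d²_H(D₁, D₂) := (1/2)·∑_{x∈X} (√(D₁(x)) − √(D₂(x)))² ≤ ε²/2. -/

import Mathlib

/-- If `0 ≤ ε ≤ 1` and `q` lies between `(1 - ε) * p` and `(1 + ε) * p`, then `(√p - √q)² ≤ ε² * p`. -/
lemma sq_sqrt_sub_sqrt_le {p q ε : ℝ} (hp : 0 ≤ p) (hε₀ : 0 ≤ ε) (hε₁ : ε ≤ 1)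
    (hlo : (1 - ε) * p ≤ q) (hhi : q ≤ (1 + ε) * p) :
    (√p - √q) ^ 2 ≤ ε ^ 2 * p := by
  have hlower : (1 - ε) * √p ≤ √q := by
    apply Real.le_sqrt_of_sq_le
    rw [mul_pow, Real.sq_sqrt hp]
    nlinarith [mul_nonneg (mul_nonneg hε₀ (sub_nonneg.2 hε₁)) hp]
  have hupper : √q ≤ (1 + ε) * √p := by
    apply Real.sqrt_le_iff.2 ⟨by positivity, ?_⟩
    rw [mul_pow, Real.sq_sqrt hp]
    nlinarith [mul_nonneg (mul_nonneg hε₀ (add_nonneg zero_le_one hε₀)) hp]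
  calc (√p - √q) ^ 2 ≤ (ε * √p) ^ 2 := sq_le_sq' (by linarith) (by linarith)
    _ = ε ^ 2 * p := by rw [mul_pow, Real.sq_sqrt hp]

/-- If two probability mass functions on a countable set have pointwise mass ratio within
`[1−ε, 1+ε]`, then their squared Hellinger distance is at most `ε²/2`. -/
theorem stmt_14 (X : Type*) [Countable X] (D₁ D₂ : X → ℝ) (ε : ℝ)
    (hε : ε ∈ Set.Icc (0:ℝ) 1)
    (hD₁_nonneg : ∀ x, 0 ≤ D₁ x) (hD₂_nonneg : ∀ x, 0 ≤ D₂ x)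
    (hD₁_sum : ∑' x, D₁ x = 1) (hD₂_sum : ∑' x, D₂ x = 1)
    (hratio : ∀ x, 0 < D₁ x → (1 - ε) * D₁ x ≤ D₂ x ∧ D₂ x ≤ (1 + ε) * D₁ x)
    (hzero : ∀ x, D₁ x = 0 → D₂ x = 0) :
    (1/2) * ∑' x, (Real.sqrt (D₁ x) - Real.sqrt (D₂ x))^2 ≤ ε^2 / 2 := by
  have hsummable : Summable D₁ := by
    by_contra h
    simp [tsum_eq_zero_of_not_summable h] at hD₁_sum
  have hle (x : X) : (√(D₁ x) - √(D₂ x)) ^ 2 ≤ ε ^ 2 * D₁ x := by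
    rcases (hD₁_nonneg x).eq_or_lt with h | h
    · simp [← h, hzero x h.symm]
    · exact sq_sqrt_sub_sqrt_le h.le hε.1 hε.2 (hratio x h).1 (hratio x h).2
  have hbound : ∑' x, (√(D₁ x) - √(D₂ x)) ^ 2 ≤ ε ^ 2 := by
    have hs := hsummable.mul_left (ε ^ 2)
    calc ∑' x, (√(D₁ x) - √(D₂ x)) ^ 2 ≤ ∑' x, ε ^ 2 * D₁ x :=
          (hs.of_nonneg_of_le (fun _ => sq_nonneg _) hle).tsum_le_tsum hle hs
      _ = ε ^ 2 := by rw [tsum_mul_left, hD₁_sum, mul_one]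
  linarith
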